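/- Let w be a finite word over {0,1,2,3,4} such that every conjugate of w is a factor of F^ω(0), w has prefix 01, and w contains at least two occurrences of the letter 1. Then there exists a finite word v such that w = f(v) (where f = F³), every conjugate of v is a factor of F^ω(0), and v contains strictly fewer occurrences of the letter 1 than w does. -/

import Mathlib

/-- The morphism F on the alphabet Σ = {0,1,2,3,4}. -/
def F : Fin 5 → List (Fin 5)
  | 0 => [0, 1]
  | 1 => [2]
  | 2 => [0, 3]
  | 3 => [2, 4]
  | 4 => [2, 3]

/-- Extension of F to words. -/
def Fw (w : List (Fin 5)) : List (Fin 5) := w.flatMap F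

/-- `u` is a factor of the fixed point F^ω(0). -/
def FactorF (u : List (Fin 5)) : Prop := ∃ n, u <:+: Fw^[n] [0]

/-- `v` is a conjugate (cyclic rotation) of `u`. -/
def Conj (u v : List (Fin 5)) : Prop := ∃ s t, u = s ++ t ∧ v = t ++ s

/-- The letter images of `F³`. -/
def cube : Fin 5 → List (Fin 5)
  | 0 => [0, 1, 2, 0, 3]
  | 1 => [0, 1, 2, 4]
  | 2 => [0, 1, 2, 0, 3, 2, 3]
  | 3 => [0, 1, 2, 4, 0, 3, 2, 4]
  | 4 => [0, 1, 2, 4, 0, 3, 2, 3]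

theorem Fw_append (u v : List (Fin 5)) : Fw (u ++ v) = Fw u ++ Fw v := by
  simp [Fw]

theorem Fw_iterate_three (w : List (Fin 5)) : Fw^[3] w = w.flatMap cube := by
  induction w with
  | nil => rfl
  | cons a w ih =>
    have key : Fw^[3] (a :: w) = Fw^[3] [a] ++ Fw^[3] w := by
      change Fw (Fw (Fw ([a] ++ w))) = _
      simp only [Fw_append]
      rfl
    rw [key, ih, List.flatMap_cons]
    congr 1
    fin_cases a <;> rfl

theorem conj_iff_isRotated (u v : List (Fin 5)) : Conj u v ↔ u ~r v := by
  constructor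
  · rintro ⟨s, t, rfl, rfl⟩
    exact List.isRotated_append
  · rintro ⟨n, rfl⟩
    exact ⟨u.take (n % u.length), u.drop (n % u.length), by simp,
      List.rotate_eq_drop_append_take_mod⟩

theorem Fw_iterate_prefix_succ (n : ℕ) : Fw^[n] [0] <+: Fw^[n + 1] [0] := by
  induction n with
  | zero => exact ⟨[1], rfl⟩
  | succ n ih =>
    obtain ⟨t, ht⟩ := ih
    rw [Function.iterate_succ_apply', Function.iterate_succ_apply' Fw (n + 1), ← ht, Fw_append]
    exact List.prefix_append _ _

/-- Every factor of the fixed point occurs in the `F³`-image of a factor. -/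
theorem FactorF.exists_cube {u : List (Fin 5)} (h : FactorF u) :
    ∃ Z P Q, FactorF Z ∧ P ++ u ++ Q = Z.flatMap cube := by
  obtain ⟨n, hn⟩ := h
  have h3 : u <:+: Fw^[3] (Fw^[n] [0]) := by
    rw [← Function.iterate_add_apply, Nat.add_comm]
    exact hn.trans (((Fw_iterate_prefix_succ n).trans ((Fw_iterate_prefix_succ (n + 1)).trans
      (Fw_iterate_prefix_succ (n + 2)))).isInfix)
  rw [Fw_iterate_three] at h3
  obtain ⟨P, Q, hPQ⟩ := h3
  exact ⟨_, P, Q, ⟨n, List.infix_rfl⟩, hPQ⟩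

theorem FactorF.of_infix {u v : List (Fin 5)} (h : FactorF v) (huv : u <:+: v) : FactorF u :=
  h.imp fun _ hn => huv.trans hn

theorem flatMap_cube_eq_nil_or (Z : List (Fin 5)) :
    Z.flatMap cube = [] ∨ ∃ q, Z.flatMap cube = 0 :: 1 :: 2 :: q := by
  cases Z with
  | nil => exact Or.inl rfl
  | cons a Z => right; fin_cases a <;> simp [cube]

/-- Occurrences of `01` in an `F³`-image are exactly at the block boundaries. -/
theorem exists_split_of_eq_flatMap_cube (Z p q : List (Fin 5))
    (h : p ++ 0 :: 1 :: q = Z.flatMap cube) :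
    ∃ Z₁ Z₂, Z = Z₁ ++ Z₂ ∧ Z₁.flatMap cube = p ∧ Z₂.flatMap cube = 0 :: 1 :: q := by
  induction Z generalizing p with
  | nil => simp at h
  | cons a Z ih =>
    rcases List.eq_nil_or_concat p with rfl | ⟨p, c, rfl⟩
    · exact ⟨[], a :: Z, rfl, rfl, h.symm⟩
    · rw [List.flatMap_cons, List.append_eq_append_iff] at h
      rcases h with ⟨r, h₁, h₂⟩ | ⟨r, h₁, h₂⟩
      · rcases r with _ | ⟨d, _ | ⟨e, r⟩⟩
        · obtain ⟨Z₁, Z₂, rfl, e₁, e₂⟩ := ih [] (by simpa using h₂)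
          refine ⟨a :: Z₁, Z₂, rfl, ?_, e₂⟩
          simp [e₁, h₁]
        · exfalso
          have := congrArg List.getLast? h₁
          simp at h₂
          fin_cases a <;> simp [cube] at this <;> omega
        · exfalso
          simp only [List.cons_append, List.cons.injEq] at h₂
          obtain ⟨rfl, rfl, -⟩ := h₂
          clear ih
          rcases p with _ | ⟨p₁, _ | ⟨p₂, _ | ⟨p₃, _ | ⟨p₄, _ | ⟨p₅, _ | ⟨p₆, _ | ⟨p₇, p⟩⟩⟩⟩⟩⟩⟩ <;>
            fin_cases a <;> simp [cube] at h₁ <;>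
            (have hlen := congrArg List.length h₁.2.2.2.2.2.2.2; simp at hlen; omega)
      · obtain ⟨Z₁, Z₂, rfl, e₁, e₂⟩ := ih r h₂.symm
        exact ⟨a :: Z₁, Z₂, rfl, by simpa [e₁] using h₁.symm, e₂⟩

theorem eq_append_of_flatMap_cube (u Z q : List (Fin 5))
    (h : u.flatMap cube ++ 0 :: 1 :: q = Z.flatMap cube) :
    ∃ Z', Z = u ++ Z' ∧ Z'.flatMap cube = 0 :: 1 :: q := by
  induction u generalizing Z with
  | nil => exact ⟨Z, rfl, h.symm⟩
  | cons a u ih =>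
    cases Z with
    | nil => simp at h
    | cons z Z =>
      have hu : ∃ q', u.flatMap cube ++ 0 :: 1 :: q = 0 :: 1 :: q' := by
        rcases flatMap_cube_eq_nil_or u with e | ⟨q', e⟩ <;> simp [e]
      have haz : a = z := by
        obtain ⟨q', hq'⟩ := hu
        rw [List.flatMap_cons, List.flatMap_cons, List.append_assoc, hq'] at h
        rcases flatMap_cube_eq_nil_or Z with e | ⟨r, e⟩ <;> rw [e] at h <;>
          fin_cases a <;> fin_cases z <;> simp [cube] at h ⊢
      subst haz
      rw [List.flatMap_cons, List.flatMap_cons, List.append_assoc, List.append_cancel_left_eq] at h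
      obtain ⟨Z', rfl, e⟩ := ih Z h
      exact ⟨Z', rfl, e⟩

theorem eq_append_of_flatMap_cube_of_ne_one (u Z q : List (Fin 5)) (y : Fin 5) (hy : y ≠ 1)
    (h : (u ++ [y]).flatMap cube ++ 0 :: q = Z.flatMap cube) :
    ∃ Z', Z = u ++ [y] ++ Z' := by
  have hc : ∃ q', cube y ++ 0 :: q = 0 :: 1 :: q' := by fin_cases y <;> simp [cube]
  obtain ⟨q', hq'⟩ := hc
  simp only [List.flatMap_append, List.flatMap_singleton, List.append_assoc] at h
  rw [hq'] at h
  obtain ⟨Z', rfl, e⟩ := eq_append_of_flatMap_cube u Z q' h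
  rw [← hq'] at e
  cases Z' with
  | nil => simp at e
  | cons z Z' =>
    have : z = y := by
      rw [List.flatMap_cons] at e
      rcases flatMap_cube_eq_nil_or Z' with e' | ⟨r, e'⟩ <;> rw [e'] at e <;>
        fin_cases y <;> fin_cases z <;> simp [cube] at e hy ⊢
    exact ⟨Z', by simp [this]⟩

theorem eq_two_of_one_cons (Z A B : List (Fin 5)) (c : Fin 5)
    (h : A ++ 1 :: c :: B = Z.flatMap cube) : c = 2 := by
  induction Z generalizing A with
  | nil => simp at h
  | cons a Z ih =>
    rw [List.flatMap_cons, List.append_eq_append_iff] at h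
    rcases h with ⟨r, h₁, h₂⟩ | ⟨r, h₁, h₂⟩
    · rcases r with _ | ⟨d, _ | ⟨e, r⟩⟩
      · exact ih [] (by simpa using h₂)
      · exfalso
        have := congrArg List.getLast? h₁
        simp at h₂
        fin_cases a <;> simp [cube] at this <;> omega
      · simp only [List.cons_append, List.cons.injEq] at h₂
        obtain ⟨rfl, rfl, -⟩ := h₂
        clear ih
        rcases A with _ | ⟨p₁, _ | ⟨p₂, _ | ⟨p₃, _ | ⟨p₄, _ | ⟨p₅, _ | ⟨p₆, _ | ⟨p₇, p⟩⟩⟩⟩⟩⟩⟩ <;>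
          fin_cases a <;> simp [cube] at h₁ <;>
          first
          | (simp [h₁]; done)
          | (have hlen := congrArg List.length h₁.2.2.2.2.2.2.2; simp at hlen; omega)
    · exact ih r h₂.symm

theorem FactorF.eq_two_of_one_cons {c : Fin 5} {B : List (Fin 5)} (h : FactorF (1 :: c :: B)) :
    c = 2 := by
  obtain ⟨Z, P, Q, -, e⟩ := h.exists_cube
  exact _root_.eq_two_of_one_cons Z P (B ++ Q) c (by simpa using e)

theorem not_factorF_cube_one_one (u : List (Fin 5)) :
    ¬ FactorF ((1 :: 1 :: u).flatMap cube) := by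
  intro h
  obtain ⟨Z, P, Q, hZ, e⟩ := h.exists_cube
  obtain ⟨Z₁, Z₂, rfl, -, e₂⟩ := exists_split_of_eq_flatMap_cube Z P
    ([2, 4, 0, 1, 2, 4] ++ u.flatMap cube ++ Q) (by rw [← e]; simp [cube])
  obtain ⟨Z₃, rfl, e₃⟩ := eq_append_of_flatMap_cube [1] Z₂ ([2, 4] ++ u.flatMap cube ++ Q)
    (by rw [e₂]; simp [cube])
  cases Z₃ with
  | nil => simp at e₃
  | cons c Z₃ =>
    have hc : c = 2 := (hZ.of_infix ⟨Z₁, [], by simp⟩ : FactorF (1 :: c :: Z₃)).eq_two_of_one_cons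
    subst hc
    simp [cube] at e₃

theorem count_one_flatMap_cube (v : List (Fin 5)) : (v.flatMap cube).count 1 = v.length := by
  induction v with
  | nil => rfl
  | cons a v ih =>
    have : (cube a).count 1 = 1 := by fin_cases a <;> rfl
    rw [List.flatMap_cons, List.count_append, ih, this, List.length_cons, Nat.add_comm]

theorem exists_eq_flatMap_cube_append (Z w Q : List (Fin 5)) (h : w ++ Q = Z.flatMap cube) :
    ∃ u r : List (Fin 5), w = u.flatMap cube ++ r ∧ (r = [] ∨ r = [0] ∨ ∃ r', r = 0 :: 1 :: r') ∧
      r.count 1 ≤ 1 := by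
  induction Z generalizing w with
  | nil => exact ⟨[], [], by simpa using (List.append_eq_nil_iff.1 h).1, by simp⟩
  | cons a Z ih =>
    rw [List.flatMap_cons, List.append_eq_append_iff] at h
    rcases h with ⟨r, h₁, -⟩ | ⟨r, rfl, h₂⟩
    · refine ⟨[], w, rfl, ?_, ?_⟩
      · rcases w with _ | ⟨c, _ | ⟨d, w⟩⟩ <;> fin_cases a <;> simp [cube] at h₁ ⊢ <;> simp [h₁]
      · have : (cube a).count 1 = 1 := by fin_cases a <;> rfl
        rw [← this, h₁, List.count_append]
        omega
    · obtain ⟨u, r', rfl, h₃, h₄⟩ := ih r h₂.symm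
      exact ⟨a :: u, r', by simp, h₃, h₄⟩

theorem exists_eq_flatMap_cube {w : List (Fin 5)} (hw : ∀ w', w ~r w' → FactorF w')
    (h01 : [0, 1] <+: w) (hcount : 2 ≤ w.count 1) : ∃ v : List (Fin 5), w = v.flatMap cube := by
  obtain ⟨Z, P, Q, -, e⟩ := (hw w (List.IsRotated.refl w)).exists_cube
  obtain ⟨t, rfl⟩ := h01
  obtain ⟨-, Z₂, -, -, e₂⟩ := exists_split_of_eq_flatMap_cube Z P (t ++ Q) (by simpa using e)
  obtain ⟨u, r, hur, hr, hr1⟩ := exists_eq_flatMap_cube_append Z₂ ([0, 1] ++ t) Q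
    (by simpa using e₂.symm)
  rw [hur] at hw hcount ⊢
  have hu : ∃ q, u.flatMap cube = 0 :: 1 :: q := by
    rcases flatMap_cube_eq_nil_or u with e' | ⟨q, e'⟩
    · rw [e', List.nil_append] at hcount
      omega
    · exact ⟨_, e'⟩
  obtain ⟨q, hq⟩ := hu
  obtain ⟨Y, P', Q', -, e'⟩ := (hw _ List.isRotated_append).exists_cube
  obtain ⟨Y₁, -, -, e₁, -⟩ := exists_split_of_eq_flatMap_cube Y (P' ++ r) (q ++ Q')
    (by rw [← e', hq]; simp)
  rcases hr with rfl | rfl | ⟨r', rfl⟩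
  · exact ⟨u, by simp⟩
  · exfalso
    rcases List.eq_nil_or_concat Y₁ with rfl | ⟨Y₁, z, rfl⟩
    · simp at e₁
    · have := congrArg List.getLast? e₁
      fin_cases z <;> simp [cube] at this
  · obtain ⟨-, V, -, -, hV⟩ := exists_split_of_eq_flatMap_cube Y₁ P' r' e₁.symm
    exact ⟨u ++ V, by rw [List.flatMap_append, hV]⟩

theorem eq_concat_of_ne_one (x : Fin 5) (hx : x ≠ 1) (s Z P : List (Fin 5))
    (hs : cube x = 0 :: 1 :: s) (h : Z.flatMap cube = P ++ s) : ∃ Z', Z = Z' ++ [x] := by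
  rcases List.eq_nil_or_concat Z with rfl | ⟨Z', z, rfl⟩
  · exfalso
    fin_cases x <;> simp [cube] at hs <;> subst hs <;> simp at h
  · refine ⟨Z', ?_⟩
    have h' := congrArg List.reverse h
    fin_cases x <;> simp [cube] at hs hx <;> subst hs <;> fin_cases z <;> simp [cube] at h' ⊢

theorem eq_concat_one (Z P : List (Fin 5)) (h : Z.flatMap cube = P ++ [1, 2, 4]) :
    ∃ Z', Z = Z' ++ [1] := by
  rcases List.eq_nil_or_concat Z with rfl | ⟨Z', z, rfl⟩
  · simp at h
  · refine ⟨Z', ?_⟩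
    have h' := congrArg List.reverse h
    fin_cases z <;> simp [cube] at h' ⊢

/-- A word of length at least two is a factor once all conjugates of its `F³`-image are. -/
theorem factorF_of_cube (x y : Fin 5) (u : List (Fin 5))
    (hw : ∀ w', (x :: (u ++ [y])).flatMap cube ~r w' → FactorF w') :
    FactorF (x :: (u ++ [y])) := by
  obtain ⟨s, hs⟩ : ∃ s, cube x = 0 :: 1 :: s := by fin_cases x <;> simp [cube]
  obtain ⟨m, hm⟩ : ∃ m, (u ++ [y]).flatMap cube = 0 :: 1 :: m := by
    rcases flatMap_cube_eq_nil_or (u ++ [y]) with e | ⟨q, e⟩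
    · exfalso
      fin_cases y <;> simp [cube] at e
    · exact ⟨_, e⟩
  by_cases hx : x = 1
  · subst hx
    by_cases hy : y = 1
    · subst hy
      refine absurd (hw _ ?_) (not_factorF_cube_one_one u)
      rw [show (1 :: (u ++ [1])).flatMap cube = (1 :: u).flatMap cube ++ cube 1 by simp,
        show (1 :: 1 :: u).flatMap cube = cube 1 ++ (1 :: u).flatMap cube by simp]
      exact List.isRotated_append
    · obtain ⟨Z, P, Q, hZ, e⟩ := (hw ([1, 2, 4] ++ (u ++ [y]).flatMap cube ++ [0])
        (List.isRotated_append (l := [0]))).exists_cube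
      obtain ⟨Z₁, Z₂, rfl, e₁, e₂⟩ := exists_split_of_eq_flatMap_cube Z (P ++ [1, 2, 4])
        (m ++ 0 :: Q) (by rw [← e, hm]; simp)
      obtain ⟨Z₁, rfl⟩ := eq_concat_one Z₁ P e₁
      obtain ⟨Z₃, rfl⟩ := eq_append_of_flatMap_cube_of_ne_one u Z₂ Q y hy (by rw [hm, e₂]; simp)
      exact hZ.of_infix ⟨Z₁, Z₃, by simp⟩
  · have hrot : (x :: (u ++ [y])).flatMap cube ~r s ++ (u ++ [y]).flatMap cube ++ [0, 1] := by
      rw [List.flatMap_cons, hs]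
      exact List.isRotated_append (l := [0, 1])
    obtain ⟨Z, P, Q, hZ, e⟩ := (hw _ hrot).exists_cube
    obtain ⟨Z₁, Z₂, rfl, e₁, e₂⟩ := exists_split_of_eq_flatMap_cube Z (P ++ s)
      (m ++ 0 :: 1 :: Q) (by rw [← e, hm]; simp)
    obtain ⟨Z₁, rfl⟩ := eq_concat_of_ne_one x hx s Z₁ P hs e₁
    obtain ⟨Z₃, rfl, -⟩ := eq_append_of_flatMap_cube (u ++ [y]) Z₂ Q (by rw [hm, e₂]; simp)
    exact hZ.of_infix ⟨Z₁, Z₃, by simp⟩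

theorem List.IsRotated.flatMap_cube {u v : List (Fin 5)} (h : u ~r v) :
    u.flatMap cube ~r v.flatMap cube := by
  obtain ⟨s, t, rfl, rfl⟩ := (conj_iff_isRotated u v).2 h
  simpa using List.isRotated_append

theorem descent_of_conjugacy_classes :
    ∀ w : List (Fin 5),
      (∀ v, Conj w v → FactorF v) → [0, 1] <+: w → 2 ≤ w.count 1 →
      ∃ v : List (Fin 5), w = Fw^[3] v ∧ (∀ v', Conj v v' → FactorF v') ∧
        v.count 1 < w.count 1 := by
  intro w hw h01 hcount
  simp only [conj_iff_isRotated] at hw ⊢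
  obtain ⟨v, rfl⟩ := exists_eq_flatMap_cube hw h01 hcount
  rw [count_one_flatMap_cube] at hcount ⊢
  refine ⟨v, (Fw_iterate_three v).symm, fun v' hv' => ?_, ?_⟩
  · have hlen := hv'.perm.length_eq
    rcases v' with _ | ⟨x, m⟩
    · simp at hlen
      simp [hlen] at hcount
    rcases List.eq_nil_or_concat m with rfl | ⟨u, y, rfl⟩
    · simp at hlen
      omega
    · rw [List.concat_eq_append] at hv' ⊢
      exact factorF_of_cube x y u fun w' hw' => hw w' (hv'.flatMap_cube.trans hw')
  · refine lt_of_le_of_ne List.count_le_length fun hall => ?_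
    rw [List.count_eq_length] at hall
    rcases v with _ | ⟨a, _ | ⟨b, v⟩⟩
    · simp at hcount
    · simp at hcount
    · obtain rfl : 1 = a := hall a (by simp)
      obtain rfl : 1 = b := hall b (by simp)
      exact not_factorF_cube_one_one v (hw _ (List.IsRotated.refl _))
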